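/- arXiv:math/0508150 — 2 statements merged into one kernel-verified Lean document; each statement's English description precedes it below -/
import Mathlib

section
/- For all real x, y > 0 with x ≠ y, (√(xy)/(x² − y²)) · (πx · J_{5/2}(πx) · J_{3/2}(πy) − J_{3/2}(πx) · πy · J_{5/2}(πy)) = sin(π(x − y))/(π(x − y)) + sin(π(x + y))/(π(x + y)) − 2 · (sin(πx)/(πx)) · (sin(πy)/(πy)); that is, the 'doubly hard' kernel K₂ = B^{(3/2)} equals S₊(x,y) − 2·sinc(πx)·sinc(πy). -/
open Real

/-- The Bessel function `J_{3/2}(t) = √(2/(πt)) (sin t / t - cos t)` for `t > 0`. -/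
noncomputable def besselJ3Half (t : ℝ) : ℝ :=
  Real.sqrt (2 / (Real.pi * t)) * (Real.sin t / t - Real.cos t)

/-- The Bessel function `J_{5/2}(t) = √(2/(πt)) ((3/t² - 1) sin t - (3/t) cos t)`
for `t > 0`. -/
noncomputable def besselJ5Half (t : ℝ) : ℝ :=
  Real.sqrt (2 / (Real.pi * t)) * ((3 / t ^ 2 - 1) * Real.sin t - (3 / t) * Real.cos t)

/-- The "doubly hard" kernel `K₂ = B^{(3/2)}` equals
`S₊(x,y) - 2 sinc(πx) sinc(πy)`. -/
theorem bessel_kernel_three_half_eq_doubly_hard (x y : ℝ) (hx : 0 < x) (hy : 0 < y)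
    (hxy : x ≠ y) :
    Real.sqrt (x * y) / (x ^ 2 - y ^ 2) *
        (Real.pi * x * besselJ5Half (Real.pi * x) * besselJ3Half (Real.pi * y) -
          besselJ3Half (Real.pi * x) * (Real.pi * y) * besselJ5Half (Real.pi * y))
      =
    Real.sin (Real.pi * (x - y)) / (Real.pi * (x - y)) +
      Real.sin (Real.pi * (x + y)) / (Real.pi * (x + y)) -
      2 * (Real.sin (Real.pi * x) / (Real.pi * x)) *
        (Real.sin (Real.pi * y) / (Real.pi * y)) := by
  have hpi := Real.pi_pos
  have hd : x - y ≠ 0 := sub_ne_zero.mpr hxy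
  have hs : x + y ≠ 0 := by positivity
  have hd2 : x ^ 2 - y ^ 2 ≠ 0 := by
    rw [sq_sub_sq]; exact mul_ne_zero hs hd
  have key : Real.sqrt (x * y) * (Real.sqrt (2 / (Real.pi * (Real.pi * x))) *
      Real.sqrt (2 / (Real.pi * (Real.pi * y)))) = 2 / Real.pi ^ 2 := by
    rw [← Real.sqrt_mul (by positivity), ← Real.sqrt_mul (by positivity)]
    rw [show x * y * (2 / (Real.pi * (Real.pi * x)) * (2 / (Real.pi * (Real.pi * y))))
      = (2 / Real.pi ^ 2) ^ 2 by field_simp]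
    exact Real.sqrt_sq (by positivity)
  unfold besselJ5Half besselJ3Half
  rw [mul_sub Real.pi x y, mul_add Real.pi x y, Real.sin_sub, Real.sin_add]
  rw [← mul_sub Real.pi x y, ← mul_add Real.pi x y]
  generalize Real.sqrt (x * y) = r at *
  generalize Real.sqrt (2 / (Real.pi * (Real.pi * x))) = p at *
  generalize Real.sqrt (2 / (Real.pi * (Real.pi * y))) = q at *
  generalize Real.sin (Real.pi * x) = sa
  generalize Real.sin (Real.pi * y) = sb
  generalize Real.cos (Real.pi * x) = ca
  generalize Real.cos (Real.pi * y) = cb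
  generalize Real.pi = P at *
  have hP : P ≠ 0 := hpi.ne'
  trans (r * (p * q)) / (x ^ 2 - y ^ 2) *
      (P * x * ((3 / (P * x) ^ 2 - 1) * sa - 3 / (P * x) * ca) * (sb / (P * y) - cb) -
        (sa / (P * x) - ca) * (P * y) * ((3 / (P * y) ^ 2 - 1) * sb - 3 / (P * y) * cb))
  · ring
  rw [key, sq_sub_sq]
  field_simp
  ring
end

section
/- For every real x > 0, (π/2) · (πx) · (J_{3/2}(πx)² − J_{1/2}(πx) · J_{5/2}(πx)) = 1 + sin(2πx)/(2πx) − 2 · (sin(πx)/(πx))²; that is, the diagonal value B^{(3/2)}(x,x) of the Bessel kernel with parameter a = 3/2 equals the nonatomic part of the 'doubly hard' central 1-level density ρ₂(x). -/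
open Real

/-- The Bessel function `J_{1/2}(t) = √(2/(πt)) sin t` for `t > 0`. -/
noncomputable def besselJHalf (t : ℝ) : ℝ := Real.sqrt (2 / (Real.pi * t)) * Real.sin t

/-- The diagonal value `B^{(3/2)}(x,x)` of the Bessel kernel equals the nonatomic
part `1 + sin(2πx)/(2πx) - 2 (sin(πx)/(πx))²` of the "doubly hard" central
1-level density `ρ₂`. -/
theorem bessel_diag_three_half_eq_doubly_hard_density (x : ℝ) (hx : 0 < x) :
    Real.pi / 2 * (Real.pi * x) *
        (besselJ3Half (Real.pi * x) ^ 2 -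
          besselJHalf (Real.pi * x) * besselJ5Half (Real.pi * x))
      = 1 + Real.sin (2 * Real.pi * x) / (2 * Real.pi * x) -
          2 * (Real.sin (Real.pi * x) / (Real.pi * x)) ^ 2 := by
  have ht : 0 < Real.pi * x := mul_pos Real.pi_pos hx
  rw [mul_assoc 2 Real.pi x]
  generalize Real.pi * x = t at ht
  have hp := Real.pi_pos.ne'
  have h1 : Real.sqrt (2 / (Real.pi * t)) ^ 2 = 2 / (Real.pi * t) :=
    Real.sq_sqrt (by positivity)
  have h2 : Real.pi / 2 * t * Real.sqrt (2 / (Real.pi * t)) ^ 2 = 1 := by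
    rw [h1]; field_simp
  have h3 := Real.sin_sq_add_cos_sq t
  unfold besselJ3Half besselJHalf besselJ5Half
  rw [Real.sin_two_mul]
  calc _ = (Real.pi / 2 * t * Real.sqrt (2 / (Real.pi * t)) ^ 2) *
        ((Real.sin t / t - Real.cos t) ^ 2 -
          Real.sin t * ((3 / t ^ 2 - 1) * Real.sin t - (3 / t) * Real.cos t)) := by ring
    _ = (Real.sin t ^ 2 + Real.cos t ^ 2) + 2 * Real.sin t * Real.cos t / (2 * t) -
          2 * (Real.sin t / t) ^ 2 := by
        rw [h2]; field_simp; ring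
    _ = _ := by rw [h3]
end
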